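/- Assume Ramos' bound: for every integer x ≥ 0, the triple (15·2^x, 5, 2^{x+1}) is admissible. Then for all integers h ≥ 5 and m ≥ 2, writing m = 2^q + r with integers q ≥ 0 and 0 < r ≤ 2^q, the triple (2^{h−5}·(14·2^q + r), h, m) is admissible; equivalently Δ(h, m) ≤ 2^{h−5}·(14·2^q + r). (Proof idea: first establish the case h = 5 using the reduction 'if (d+1, h, m+1) is admissible then so is (d, h, m)', then induct on h using the reduction 'if (d, h−1, 2m) is admissible then so is (d, h, m)', noting that doubling m = 2^q + r gives 2m = 2^{q+1} + 2r with 0 < 2r ≤ 2^{q+1}.) -/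

import Mathlib

open MeasureTheory

/-- A *mass* in `ℝ^d`: a finite Borel measure for which every affine hyperplane
(zero set of an affine functional with nonzero linear part) is a null set. -/
def IsMass (d : ℕ) (μ : Measure (Fin d → ℝ)) : Prop :=
  IsFiniteMeasure μ ∧
    ∀ f : (Fin d → ℝ) →ᵃ[ℝ] ℝ, f.linear ≠ 0 → μ {x | f x = 0} = 0

/-- The `h` hyperplanes determined by the nonzero affine functionals `f i`
cut the mass `μ` into `2^h` equal pieces: every orthant given by a sign
vector `ε ∈ {−1,+1}^h` (encoded by `Bool`) has measure `μ(ℝ^d)/2^h`. -/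
def Cuts (d h : ℕ) (f : Fin h → ((Fin d → ℝ) →ᵃ[ℝ] ℝ))
    (μ : Measure (Fin d → ℝ)) : Prop :=
  ∀ ε : Fin h → Bool,
    μ {x | ∀ i, 0 ≤ (if ε i then f i x else -(f i x))} = μ Set.univ / 2 ^ h

/-- `(d, h, m)` is admissible: any `m` masses in `ℝ^d` can be simultaneously cut
into `2^h` equal pieces by `h` affine hyperplanes. -/
def Admissible (d h m : ℕ) : Prop :=
  ∀ μ : Fin m → Measure (Fin d → ℝ), (∀ j, IsMass d (μ j)) →
    ∃ f : Fin h → ((Fin d → ℝ) →ᵃ[ℝ] ℝ),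
      (∀ i, (f i).linear ≠ 0) ∧ ∀ j, Cuts d h f (μ j)

/-- `Δ(h, m)`: the smallest positive dimension `d` such that `(d, h, m)` is admissible. -/
noncomputable def Delta (h m : ℕ) : ℕ := sInf {d | 0 < d ∧ Admissible d h m}

theorem measurableSet_halfSpace {d : ℕ} (b : Bool) (f : (Fin d → ℝ) →ᵃ[ℝ] ℝ) :
    MeasurableSet {x | 0 ≤ (if b then f x else -(f x))} := by
  have hf : Measurable f := f.continuous_of_finiteDimensional.measurable
  cases b
  · simpa using measurableSet_le hf measurable_const
  · simpa using measurableSet_le measurable_const hf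

theorem measurableSet_orthant {d h : ℕ} (ε : Fin h → Bool)
    (f : Fin h → ((Fin d → ℝ) →ᵃ[ℝ] ℝ)) :
    MeasurableSet {x | ∀ i, 0 ≤ (if ε i then f i x else -(f i x))} := by
  rw [Set.ofPred_forall]
  exact MeasurableSet.iInter fun i => measurableSet_halfSpace (ε i) (f i)

theorem IsMass.restrict {d : ℕ} {μ : Measure (Fin d → ℝ)} (hμ : IsMass d μ)
    (s : Set (Fin d → ℝ)) : IsMass d (μ.restrict s) := by
  have := hμ.1
  exact ⟨inferInstance, fun f hf =>
    le_antisymm ((Measure.restrict_le_self _).trans (hμ.2 f hf).le) (zero_le)⟩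

/-- Each single hyperplane of an equipartition bisects the measure. -/
theorem Cuts.halfSpace {d h : ℕ} {f : Fin (h + 1) → ((Fin d → ℝ) →ᵃ[ℝ] ℝ)}
    {μ : Measure (Fin d → ℝ)} [IsFiniteMeasure μ] (hc : Cuts d (h + 1) f μ) (i : Fin (h + 1))
    (b : Bool) : μ {x | 0 ≤ (if b then f i x else -(f i x))} = μ Set.univ / 2 := by
  have key : ∀ b : Bool, μ {x | 0 ≤ (if b then f i x else -(f i x))} ≤ μ Set.univ / 2 := by
    intro b
    have hsub : {x | 0 ≤ (if b then f i x else -(f i x))} ⊆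
        ⋃ ε : Fin h → Bool, {x | ∀ k, 0 ≤ (if (Fin.insertNth i b ε : Fin (h + 1) → Bool) k
          then f k x else -(f k x))} := by
      intro x hx
      refine Set.mem_iUnion.2 ⟨fun k => decide (0 ≤ f (i.succAbove k) x), ?_⟩
      simp only [Set.mem_ofPred_eq] at hx ⊢
      rw [Fin.forall_iff_succAbove i]
      refine ⟨by simpa using hx, fun k => ?_⟩
      simp only [Fin.insertNth_apply_succAbove, decide_eq_true_eq]
      split_ifs with h0
      · exact h0
      · linarith
    refine (measure_mono hsub).trans ((measure_iUnion_le _).trans ?_)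
    simp only [hc _, tsum_fintype, Finset.sum_const, Finset.card_univ, Fintype.card_fun,
      Fintype.card_bool, Fintype.card_fin, nsmul_eq_mul, Nat.cast_pow, Nat.cast_ofNat]
    rw [pow_succ, ENNReal.div_eq_inv_mul, ENNReal.div_eq_inv_mul,
      ENNReal.mul_inv (by simp) (by simp), ← mul_assoc, ← mul_assoc,
      ENNReal.mul_inv_cancel (by simp) (by simp), one_mul]
  have hsum : μ Set.univ ≤ μ {x | 0 ≤ (if b then f i x else -(f i x))} +
      μ {x | 0 ≤ (if !b then f i x else -(f i x))} := by
    refine (measure_mono fun x _ => ?_).trans (measure_union_le _ _)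
    cases b <;> simp [le_total, or_comm]
  refine le_antisymm (key b) ?_
  have h2 := hsum.trans (add_le_add_right (key (!b)) _)
  have h3 : μ Set.univ / 2 + μ Set.univ / 2 ≤
      μ {x | 0 ≤ (if b then f i x else -(f i x))} + μ Set.univ / 2 := by
    rwa [ENNReal.add_halves]
  exact (ENNReal.add_le_add_iff_right
    (ENNReal.div_ne_top (measure_ne_top μ _) (by simp))).1 h3

theorem Cuts.cons {d h : ℕ} {g : (Fin d → ℝ) →ᵃ[ℝ] ℝ} {f : Fin h → ((Fin d → ℝ) →ᵃ[ℝ] ℝ)}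
    {μ : Measure (Fin d → ℝ)}
    (hg : ∀ b : Bool, μ {x | 0 ≤ (if b then g x else -(g x))} = μ Set.univ / 2)
    (hf : ∀ b : Bool, Cuts d h f (μ.restrict {x | 0 ≤ (if b then g x else -(g x))})) :
    Cuts d (h + 1) (Fin.cons g f) μ := by
  intro ε
  have h1 := hf (ε 0) (fun i => ε i.succ)
  rw [Measure.restrict_apply (measurableSet_orthant _ _), Measure.restrict_apply_univ, hg] at h1
  have h2 : {x | ∀ i, 0 ≤ (if ε i then (Fin.cons g f : Fin (h + 1) → _) i x
        else -((Fin.cons g f : Fin (h + 1) → ((Fin d → ℝ) →ᵃ[ℝ] ℝ)) i x))} =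
      {x | ∀ i : Fin h, 0 ≤ (if ε i.succ then f i x else -(f i x))} ∩
        {x | 0 ≤ (if ε 0 then g x else -(g x))} := by
    ext x
    simp [Fin.forall_fin_succ, and_comm]
  rw [h2, h1, pow_succ, mul_comm, ENNReal.div_eq_inv_mul, ENNReal.div_eq_inv_mul,
    ENNReal.div_eq_inv_mul, ENNReal.mul_inv (by simp) (by simp), ← mul_assoc,
    mul_comm (2⁻¹ : ENNReal)]

/-- One more hyperplane for half as many masses: bisect every mass first, then cut the halves. -/
theorem Admissible.succ_of_two_mul {d h m : ℕ} (had : Admissible d (h + 1) (2 * m)) :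
    Admissible d (h + 2) m := by
  let e : Fin m × Bool ≃ Fin (2 * m) := Fintype.equivOfCardEq (by simp [mul_comm])
  have family : ∀ ν : Fin m × Bool → Measure (Fin d → ℝ), (∀ p, IsMass d (ν p)) →
      ∃ f : Fin (h + 1) → ((Fin d → ℝ) →ᵃ[ℝ] ℝ),
        (∀ i, (f i).linear ≠ 0) ∧ ∀ p, Cuts d (h + 1) f (ν p) := by
    intro ν hν
    obtain ⟨f, hf, hc⟩ := had (fun j => ν (e.symm j)) (fun j => hν _)
    exact ⟨f, hf, fun p => by simpa using hc (e p)⟩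
  intro μ hμ
  obtain ⟨g, hg, hgc⟩ := family (fun p => μ p.1) (fun p => hμ _)
  obtain ⟨f, hf, hfc⟩ := family
    (fun p => (μ p.1).restrict {x | 0 ≤ (if p.2 then g 0 x else -(g 0 x))})
    (fun p => (hμ _).restrict _)
  refine ⟨Fin.cons (g 0) f, Fin.forall_fin_succ.2 ⟨hg 0, hf⟩, fun j => ?_⟩
  have := (hμ j).1
  exact Cuts.cons (fun b => (hgc (j, b)).halfSpace 0 b) (fun b => hfc (j, b))

/-- The uniform measure on the unit cube centred at the origin. -/
noncomputable def cubeMass (d : ℕ) : Measure (Fin d → ℝ) :=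
  volume.restrict (Metric.ball 0 1)

instance (d : ℕ) : IsFiniteMeasure (cubeMass d) :=
  ⟨by simp [cubeMass]⟩

theorem isMass_cubeMass (d : ℕ) : IsMass d (cubeMass d) := by
  refine ⟨inferInstance, fun f hf => ?_⟩
  refine le_antisymm ((Measure.restrict_le_self _).trans (le_of_eq ?_)) (zero_le)
  rcases Set.eq_empty_or_nonempty {x | f x = 0} with h0 | ⟨p, hp⟩
  · simp [h0]
  have hp : f p = 0 := hp
  have h1 : {x | f x = 0} = (fun x => x + -p) ⁻¹' (LinearMap.ker f.linear : Set (Fin d → ℝ)) := by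
    ext x
    have := f.linearMap_vsub x p
    simp only [vsub_eq_sub, hp, sub_zero] at this
    simp [← sub_eq_add_neg, this]
  rw [h1, measure_preimage_add_right]
  exact Measure.addHaar_submodule _ _ (by simpa [LinearMap.ker_eq_top] using hf)

theorem map_neg_cubeMass (d : ℕ) : (cubeMass d).map Neg.neg = cubeMass d := by
  have h := (Measure.measurePreserving_neg (volume : Measure (Fin d → ℝ))).restrict_preimage
    (s := Metric.ball 0 1) measurableSet_ball
  have h2 : Neg.neg ⁻¹' Metric.ball (0 : Fin d → ℝ) 1 = Metric.ball 0 1 := by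
    ext x; simp
  rw [h2] at h
  exact h.map_eq

/-- A hyperplane bisecting the centred cube passes through its centre. -/
theorem apply_zero_eq_zero_of_bisects_cubeMass {d : ℕ} (f : (Fin d → ℝ) →ᵃ[ℝ] ℝ)
    (hf : cubeMass d {x | 0 ≤ f x} = cubeMass d {x | 0 ≤ -f x}) : f 0 = 0 := by
  have aux : ∀ f : (Fin d → ℝ) →ᵃ[ℝ] ℝ,
      cubeMass d {x | 0 ≤ f x} = cubeMass d {x | 0 ≤ -f x} → ¬ 0 < f 0 := by
    intro f hf h0
    have hcont : Continuous f := f.continuous_of_finiteDimensional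
    have hlin : ∀ x, f (-x) = 2 * f 0 - f x := by
      intro x
      have h1 := congrFun f.decomp x
      have h2 := congrFun f.decomp (-x)
      simp only [Pi.add_apply, map_neg] at h1 h2
      linarith
    have hsub : {x | 2 * f 0 ≤ f x} ⊆ {x | 0 ≤ f x} := fun x (hx : 2 * f 0 ≤ f x) => by
      show 0 ≤ f x
      linarith
    have hmeas : MeasurableSet {x | 2 * f 0 ≤ f x} :=
      measurableSet_le measurable_const hcont.measurable
    have hrefl : cubeMass d {x | 2 * f 0 ≤ f x} = cubeMass d {x | 0 ≤ -f x} := by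
      conv_rhs => rw [← map_neg_cubeMass]
      have hneg : MeasurableSet {x | 0 ≤ -f x} :=
        measurableSet_le measurable_const hcont.measurable.neg
      rw [Measure.map_apply measurable_neg hneg]
      congr 1
      ext x
      simp [hlin]
    have hdiff : cubeMass d ({x | 0 ≤ f x} \ {x | 2 * f 0 ≤ f x}) = 0 := by
      rw [measure_sdiff hsub hmeas.nullMeasurableSet (measure_ne_top _ _), hrefl, hf, tsub_self]
    have hopen : IsOpen ({x | 0 < f x} ∩ {x | f x < 2 * f 0}) :=
      (isOpen_lt continuous_const hcont).inter (isOpen_lt hcont continuous_const)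
    have hzero : cubeMass d ({x | 0 < f x} ∩ {x | f x < 2 * f 0}) = 0 :=
      by
      refine measure_mono_null ?_ hdiff
      rintro x ⟨h1 : 0 < f x, h2 : f x < 2 * f 0⟩
      exact ⟨h1.le, fun h3 : 2 * f 0 ≤ f x => absurd h2 (not_lt.2 h3)⟩
    rw [cubeMass, Measure.restrict_apply hopen.measurableSet] at hzero
    refine ((hopen.inter Metric.isOpen_ball).measure_pos volume ⟨0, ⟨h0, ?_⟩, ?_⟩).ne' hzero
    · show f 0 < 2 * f 0
      linarith
    · simp
  refine le_antisymm (not_lt.1 (aux f hf)) (not_lt.1 fun h0 => aux (-f) ?_ (by simpa using h0))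
  simpa using hf.symm

/-- The inclusion of `ℝ^d` into `ℝ^(d+1)` as the affine hyperplane of height `1`. -/
def heightOne (d : ℕ) : (Fin d → ℝ) →ᵃ[ℝ] (Fin (d + 1) → ℝ) where
  toFun x := Fin.cons 1 x
  linear :=
    { toFun := fun x => Fin.cons 0 x
      map_add' := fun x y => by ext i; refine Fin.cases ?_ (fun k => ?_) i <;> simp
      map_smul' := fun c x => by ext i; refine Fin.cases ?_ (fun k => ?_) i <;> simp }
  map_vadd' p v := by ext i; refine Fin.cases ?_ (fun k => ?_) i <;> simp

theorem linear_heightOne_ne_zero {d : ℕ} {L : (Fin (d + 1) → ℝ) →ₗ[ℝ] ℝ} (hL : L ≠ 0)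
    (h0 : L ∘ₗ (heightOne d).linear = 0) (x : Fin d → ℝ) : L (heightOne d x) ≠ 0 := by
  intro hx
  apply hL
  ext1 i
  ext
  have key : ∀ y : Fin (d + 1) → ℝ, L y = 0 := by
    intro y
    have hy : y = y 0 • heightOne d x + (heightOne d).linear (Fin.tail y - y 0 • x) := by
      ext i
      refine Fin.cases ?_ (fun k => ?_) i <;> simp [heightOne, Fin.tail]
    have h1 := LinearMap.congr_fun h0 (Fin.tail y - y 0 • x)
    simp only [LinearMap.comp_apply, LinearMap.zero_apply] at h1
    rw [hy, map_add, map_smul, hx, h1]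
    simp
  simp [key]

/-- Points `(x, s)` parametrize the cone over the height-one hyperplane. -/
noncomputable def conePoint (d : ℕ) (p : (Fin d → ℝ) × ℝ) : Fin (d + 1) → ℝ :=
  Real.exp p.2 • heightOne d p.1

theorem measurable_conePoint (d : ℕ) : Measurable (conePoint d) :=
  ((Real.continuous_exp.comp continuous_snd).smul
    ((heightOne d).continuous_of_finiteDimensional.comp continuous_fst)).measurable

/-- The measure on `ℝ^(d+1)` obtained by spreading `μ` along the rays of the cone over it. -/
noncomputable def coneMass (d : ℕ) (μ : Measure (Fin d → ℝ)) : Measure (Fin (d + 1) → ℝ) :=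
  (μ.prod (volume.restrict (Set.Icc (0 : ℝ) 1))).map (conePoint d)

theorem IsMass.coneMass {d : ℕ} {μ : Measure (Fin d → ℝ)} (hμ : IsMass d μ) :
    IsMass (d + 1) (coneMass d μ) := by
  have := hμ.1
  refine ⟨by unfold _root_.coneMass; infer_instance, fun F hF => ?_⟩
  have hmeas : MeasurableSet {x | F x = 0} :=
    (isClosed_eq F.continuous_of_finiteDimensional continuous_const).measurableSet
  rw [_root_.coneMass, Measure.map_apply (measurable_conePoint d) hmeas,
    Measure.measure_prod_null (measurable_conePoint d hmeas)]
  have hae : ∀ᵐ x ∂μ, F.linear (heightOne d x) ≠ 0 := by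
    by_cases h0 : F.linear ∘ₗ (heightOne d).linear = 0
    · exact Filter.Eventually.of_forall (linear_heightOne_ne_zero hF h0)
    · rw [ae_iff]
      simpa using hμ.2 (F.linear.toAffineMap.comp (heightOne d)) (by simpa using h0)
  filter_upwards [hae] with x hx
  refine Set.Subsingleton.measure_zero (fun s hs t ht => ?_) _
  have happ : ∀ s, F (conePoint d (x, s)) = Real.exp s * F.linear (heightOne d x) + F 0 := by
    intro s
    have h1 := congrFun F.decomp (conePoint d (x, s))
    simpa [conePoint] using h1
  have hs : F (conePoint d (x, s)) = 0 := hs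
  have ht : F (conePoint d (x, t)) = 0 := ht
  rw [happ] at hs ht
  exact Real.exp_injective (mul_right_cancel₀ hx (by linarith))

theorem Cuts.of_coneMass {d h : ℕ} {μ : Measure (Fin d → ℝ)} [IsFiniteMeasure μ]
    {F : Fin h → ((Fin (d + 1) → ℝ) →ᵃ[ℝ] ℝ)} (hF : ∀ i, F i 0 = 0)
    (hc : Cuts (d + 1) h F (coneMass d μ)) :
    Cuts d h (fun i => (F i).comp (heightOne d)) μ := by
  intro ε
  have hprod : ∀ s : Set (Fin d → ℝ),
      μ.prod (volume.restrict (Set.Icc (0 : ℝ) 1)) (s ×ˢ Set.univ) = μ s := by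
    intro s
    simp [Measure.prod_prod]
  have h1 := hc ε
  rw [coneMass, Measure.map_apply (measurable_conePoint d) (measurableSet_orthant _ _),
    Measure.map_apply (measurable_conePoint d) MeasurableSet.univ, Set.preimage_univ,
    ← Set.univ_prod_univ, hprod] at h1
  rw [← h1, ← hprod]
  congr 1
  ext ⟨x, s⟩
  have happ : ∀ i, F i (conePoint d (x, s)) = Real.exp s * F i (heightOne d x) := by
    intro i
    have h1 := congrFun (F i).decomp (conePoint d (x, s))
    have h2 := congrFun (F i).decomp (heightOne d x)
    simp only [Pi.add_apply, hF, add_zero] at h1 h2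
    rw [h1, h2, conePoint, map_smul, smul_eq_mul]
  simp only [Set.mem_prod, Set.mem_univ, and_true, Set.mem_preimage, Set.mem_ofPred_eq, happ,
    AffineMap.comp_apply]
  refine forall_congr' fun i => ?_
  have hpos := Real.exp_pos s
  split_ifs
  · exact (mul_nonneg_iff_of_pos_left hpos).symm
  · rw [← mul_neg]
    exact (mul_nonneg_iff_of_pos_left hpos).symm

theorem Cuts.linear_ne_zero {d h : ℕ} {f : Fin (h + 1) → ((Fin d → ℝ) →ᵃ[ℝ] ℝ)}
    {μ : Measure (Fin d → ℝ)} [IsFiniteMeasure μ] (hμ : μ ≠ 0) (hc : Cuts d (h + 1) f μ)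
    (i : Fin (h + 1)) (hi : ∃ x, f i x ≠ 0) : (f i).linear ≠ 0 := by
  intro h0
  obtain ⟨p, hp⟩ := hi
  obtain ⟨c, hfc⟩ := (f i).linear_eq_zero_iff_exists_const.1 h0
  have hval : ∀ x, f i x = c := fun x => by rw [hfc]; rfl
  have hc0 : c ≠ 0 := hval p ▸ hp
  have h1 := hc.halfSpace i (decide (c < 0))
  have h2 : {x | 0 ≤ (if decide (c < 0) then f i x else -(f i x))} = ∅ := by
    ext x
    simp only [hval, decide_eq_true_eq, Set.mem_ofPred_eq, Set.mem_empty_iff_false, iff_false,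
      not_le]
    split_ifs with h
    · exact h
    · exact neg_neg_of_pos (lt_of_le_of_ne (not_lt.1 h) hc0.symm)
  rw [h2, measure_empty, eq_comm, ENNReal.div_eq_zero_iff] at h1
  simp [hμ] at h1

theorem cuts_zero_measure (d h : ℕ) (f : Fin h → ((Fin d → ℝ) →ᵃ[ℝ] ℝ)) : Cuts d h f 0 := by
  intro ε
  simp

/-- Lowering the dimension by one at the cost of one mass: the extra mass forces all
hyperplanes in `ℝ^(d+1)` to be linear, and linear hyperplanes cut cones over masses in `ℝ^d`. -/
theorem Admissible.of_succ_succ {d h m : ℕ} (hd : 0 < d)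
    (had : Admissible (d + 1) (h + 1) (m + 1)) : Admissible d (h + 1) m := by
  intro μ hμ
  by_cases hzero : ∀ j, μ j = 0
  · refine ⟨fun _ => (LinearMap.proj ⟨0, hd⟩ : (Fin d → ℝ) →ₗ[ℝ] ℝ).toAffineMap, fun _ h0 => ?_,
      fun j => hzero j ▸ cuts_zero_measure _ _ _⟩
    have h1 := LinearMap.congr_fun h0 (fun _ => 1)
    simp at h1
  · push Not at hzero
    obtain ⟨j₀, hj₀⟩ := hzero
    obtain ⟨F, hF, hc⟩ := had (Fin.cons (cubeMass (d + 1)) fun j => coneMass d (μ j))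
      (Fin.forall_fin_succ.2 ⟨isMass_cubeMass _, fun j => (hμ j).coneMass⟩)
    have hcube : Cuts (d + 1) (h + 1) F (cubeMass (d + 1)) := hc 0
    have hcone : ∀ j, Cuts (d + 1) (h + 1) F (coneMass d (μ j)) := fun j => hc j.succ
    have hF0 : ∀ i, F i 0 = 0 := fun i => by
      refine apply_zero_eq_zero_of_bisects_cubeMass _ ?_
      have h1 := hcube.halfSpace i true
      have h2 := hcube.halfSpace i false
      simp only [if_true] at h1
      simp only [Bool.false_eq_true, if_false] at h2
      rw [h1, h2]
    have hcut : ∀ j, Cuts d (h + 1) (fun i => (F i).comp (heightOne d)) (μ j) := fun j => by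
      have := (hμ j).1
      exact Cuts.of_coneMass hF0 (hcone j)
    refine ⟨_, fun i h0 => ?_, hcut⟩
    have := (hμ j₀).1
    refine Cuts.linear_ne_zero hj₀ (hcut j₀) i ⟨0, ?_⟩ h0
    have h1 := congrFun (F i).decomp (heightOne d 0)
    simp only [Pi.add_apply, hF0, add_zero] at h1
    rw [AffineMap.comp_apply, h1]
    exact linear_heightOne_ne_zero (hF i) h0 0

theorem Admissible.of_add_add {d h m : ℕ} (hd : 0 < d) (k : ℕ)
    (had : Admissible (d + k) (h + 1) (m + k)) : Admissible d (h + 1) m := by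
  induction k with
  | zero => exact had
  | succ k ih => exact ih (Admissible.of_succ_succ (by omega) had)

/-- Assuming Ramos' bound `(15·2^x, 5, 2^{x+1})` is admissible for
all `x ≥ 0`, for all `h ≥ 5` and `m = 2^q + r ≥ 2` with `0 < r ≤ 2^q`, the
triple `(2^{h−5}·(14·2^q + r), h, m)` is admissible. -/
theorem admissible_ge_five_hyperplanes
    (ramos : ∀ x : ℕ, Admissible (15 * 2 ^ x) 5 (2 ^ (x + 1)))
    (h m q r : ℕ) (hh : 5 ≤ h) (hm : 2 ≤ m) (hr : 0 < r) (hrq : r ≤ 2 ^ q)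
    (hmqr : m = 2 ^ q + r) :
    Admissible (2 ^ (h - 5) * (14 * 2 ^ q + r)) h m := by
  subst hmqr
  obtain ⟨n, rfl⟩ := Nat.exists_eq_add_of_le hh
  clear hh hm
  induction n generalizing q r with
  | zero =>
    obtain ⟨k, hk⟩ := Nat.exists_eq_add_of_le hrq
    refine Admissible.of_add_add (h := 4) (by simp) k ?_
    have h1 := ramos q
    have h2 : 2 ^ (5 + 0 - 5) * (14 * 2 ^ q + r) + k = 15 * 2 ^ q := by simp; omega
    have h3 : 2 ^ q + r + k = 2 ^ (q + 1) := by rw [pow_succ]; omega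
    rwa [h2, h3]
  | succ n ih =>
    have h1 := ih (q + 1) (2 * r) (by omega) (by rw [pow_succ]; omega)
    have h2 : 2 ^ (5 + n - 5) * (14 * 2 ^ (q + 1) + 2 * r) =
        2 ^ (5 + (n + 1) - 5) * (14 * 2 ^ q + r) := by
      rw [Nat.add_sub_cancel_left, Nat.add_sub_cancel_left]; ring
    have h3 : 2 ^ (q + 1) + 2 * r = 2 * (2 ^ q + r) := by ring
    rw [h2, h3, show 5 + n = (4 + n) + 1 by omega] at h1
    rw [show 5 + (n + 1) = (4 + n) + 2 by omega] at h1 ⊢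
    exact h1.succ_of_two_mul
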